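/- Let ν be a probability measure on ℝ^k with ∫_{ℝ^k}|x|² ν(dx) < +∞, and let ν^n be the empirical measure of an i.i.d. sample from ν. Then lim_{n→+∞} E[d²(ν^n, ν)] = 0. -/

import Mathlib

open MeasureTheory ProbabilityTheory

/-- The 2-Wasserstein (Vaserstein) distance between probability measures on `ℝ^k`,
defined as the infimum over couplings `Q` (with integrable quadratic cost) of
`(∫ |x - y|² dQ)^{1/2}`. -/
noncomputable def wassersteinDist {k : ℕ}
    (μ ν : Measure (EuclideanSpace ℝ (Fin k))) : ℝ :=
  sInf { r : ℝ | ∃ Q : Measure (EuclideanSpace ℝ (Fin k) × EuclideanSpace ℝ (Fin k)),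
    IsProbabilityMeasure Q ∧ Q.map Prod.fst = μ ∧ Q.map Prod.snd = ν ∧
    Integrable (fun p => ‖p.1 - p.2‖ ^ 2) Q ∧
    r = Real.sqrt (∫ p, ‖p.1 - p.2‖ ^ 2 ∂Q) }

/-- The empirical measure `ν^n = (1/n) ∑_{j=1}^n δ_{ξ_j(ω)}`. -/
noncomputable def empiricalMeasure {k : ℕ} {Ω : Type*}
    (ξ : ℕ → Ω → EuclideanSpace ℝ (Fin k)) (n : ℕ) (ω : Ω) :
    Measure (EuclideanSpace ℝ (Fin k)) :=
  (n : ENNReal)⁻¹ • ∑ j ∈ Finset.range n, Measure.dirac (ξ j ω)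


lemma complete_coupling {X : Type*} [MeasurableSpace X] (μ ν : Measure X)
    [IsProbabilityMeasure μ] [IsProbabilityMeasure ν] (Q1 : Measure (X × X))
    (h1 : Q1.map Prod.fst ≤ μ) (h2 : Q1.map Prod.snd ≤ ν) :
    ∃ Q : Measure (X × X), IsProbabilityMeasure Q ∧ Q.map Prod.fst = μ ∧ Q.map Prod.snd = ν ∧
      ∀ s, Q s ≤ Q1 s + (1 - Q1 Set.univ) := by
  have hf : IsFiniteMeasure (Q1.map Prod.fst) := isFiniteMeasure_of_le μ h1
  have hs : IsFiniteMeasure (Q1.map Prod.snd) := isFiniteMeasure_of_le ν h2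
  have m1 : Q1.map Prod.fst Set.univ = Q1 Set.univ := by
    rw [Measure.map_apply measurable_fst .univ]; simp
  have m2 : Q1.map Prod.snd Set.univ = Q1 Set.univ := by
    rw [Measure.map_apply measurable_snd .univ]; simp
  set μ' := μ - Q1.map Prod.fst with hμ'
  set ν' := ν - Q1.map Prod.snd with hν'
  set δ := 1 - Q1 Set.univ with hδ
  have e1 : μ' Set.univ = δ := by
    rw [hμ', Measure.sub_apply .univ h1, m1, measure_univ]
  have e2 : ν' Set.univ = δ := by
    rw [hν', Measure.sub_apply .univ h2, m2, measure_univ]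
  have hδt : δ ≠ ⊤ := by simp [hδ]
  have k1 : δ⁻¹ • (δ • μ') = μ' := by
    by_cases h : δ = 0
    · have : μ' = 0 := by rw [← Measure.measure_univ_eq_zero, e1, h]
      rw [this]; simp
    · rw [smul_smul, ENNReal.inv_mul_cancel h hδt, one_smul]
  have k2 : δ⁻¹ • (δ • ν') = ν' := by
    by_cases h : δ = 0
    · have : ν' = 0 := by rw [← Measure.measure_univ_eq_zero, e2, h]
      rw [this]; simp
    · rw [smul_smul, ENNReal.inv_mul_cancel h hδt, one_smul]
  have g1 : (Q1 + δ⁻¹ • (μ'.prod ν')).map Prod.fst = μ := by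
    rw [Measure.map_add _ _ measurable_fst, Measure.map_smul, Measure.map_fst_prod, e2, k1, add_comm]
    exact Measure.sub_add_cancel_of_le h1
  have g2 : (Q1 + δ⁻¹ • (μ'.prod ν')).map Prod.snd = ν := by
    rw [Measure.map_add _ _ measurable_snd, Measure.map_smul, Measure.map_snd_prod, e1, k2, add_comm]
    exact Measure.sub_add_cancel_of_le h2
  refine ⟨Q1 + δ⁻¹ • (μ'.prod ν'), ⟨?_⟩, g1, g2, fun s => ?_⟩
  · have : (Q1 + δ⁻¹ • (μ'.prod ν')).map Prod.fst Set.univ = 1 := by rw [g1]; simp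
    rwa [Measure.map_apply measurable_fst .univ] at this
  · rw [Measure.add_apply]
    gcongr
    refine (measure_mono (Set.subset_univ s)).trans ?_
    rw [Measure.smul_apply, ← Set.univ_prod_univ, Measure.prod_prod, e1, e2, smul_eq_mul, ← mul_assoc]
    calc δ⁻¹ * δ * δ ≤ 1 * δ := by gcongr; exact ENNReal.inv_mul_le_one _
      _ = δ := one_mul _

lemma exists_coupling {X : Type*} [MeasurableSpace X] (μ ν : Measure X)
    [IsProbabilityMeasure μ] [IsProbabilityMeasure ν] {Y : Type*} (T : SimpleFunc X Y) :
    ∃ Q : Measure (X × X), IsProbabilityMeasure Q ∧ Q.map Prod.fst = μ ∧ Q.map Prod.snd = ν ∧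
      Q.real {p | T p.1 ≠ T p.2} ≤ ∑ t ∈ T.range, |μ.real (T ⁻¹' {t}) - ν.real (T ⁻¹' {t})| := by
  classical
  set a : Y → ENNReal := fun t => μ (T ⁻¹' {t}) with ha
  set b : Y → ENNReal := fun t => ν (T ⁻¹' {t}) with hb
  have hat : ∀ t, a t ≠ ⊤ := fun t => measure_ne_top _ _
  have hbt : ∀ t, b t ≠ ⊤ := fun t => measure_ne_top _ _
  set m : Y → ENNReal := fun t => min (a t) (b t) with hm
  set R : Y → Measure (X × X) := fun t =>
    (m t * (a t)⁻¹ * (b t)⁻¹) • ((μ.restrict (T ⁻¹' {t})).prod (ν.restrict (T ⁻¹' {t}))) with hR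
  set Q1 : Measure (X × X) := ∑ t ∈ T.range, R t with hQ1
  have key1 : ∀ t, m t * (a t)⁻¹ * (b t)⁻¹ * b t ≤ 1 := by
    intro t
    calc m t * (a t)⁻¹ * (b t)⁻¹ * b t = (m t * (a t)⁻¹) * ((b t)⁻¹ * b t) := by ring
      _ ≤ (a t * (a t)⁻¹) * 1 := by
        gcongr
        · exact min_le_left _ _
        · exact ENNReal.inv_mul_le_one _
      _ ≤ 1 := by rw [mul_one]; exact ENNReal.mul_inv_le_one _
  have key2 : ∀ t, m t * (a t)⁻¹ * (b t)⁻¹ * a t ≤ 1 := by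
    intro t
    calc m t * (a t)⁻¹ * (b t)⁻¹ * a t = (m t * (b t)⁻¹) * ((a t)⁻¹ * a t) := by ring
      _ ≤ (b t * (b t)⁻¹) * 1 := by
        gcongr
        · exact min_le_right _ _
        · exact ENNReal.inv_mul_le_one _
      _ ≤ 1 := by rw [mul_one]; exact ENNReal.mul_inv_le_one _
  have decomp : ∀ (ρ : Measure X) (s : Set X), MeasurableSet s →
      ∑ t ∈ T.range, (ρ.restrict (T ⁻¹' {t})) s = ρ s := by
    intro ρ s hs
    have := SimpleFunc.sum_range_measure_preimage_singleton T (ρ.restrict s)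
    rw [Measure.restrict_apply_univ] at this
    rw [← this]
    refine Finset.sum_congr rfl fun t _ => ?_
    rw [Measure.restrict_apply hs, Measure.restrict_apply (T.measurableSet_fiber t), Set.inter_comm]
  have h1 : Q1.map Prod.fst ≤ μ := by
    refine Measure.le_iff.2 fun s hs => ?_
    rw [Measure.map_apply measurable_fst hs, hQ1, Measure.finsetSum_apply, ← decomp μ s hs]
    refine Finset.sum_le_sum fun t _ => ?_
    rw [← Measure.map_apply measurable_fst hs, hR]
    simp only [Measure.map_smul, Measure.map_fst_prod, Measure.smul_apply, smul_eq_mul,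
      Measure.restrict_apply_univ]
    rw [← mul_assoc]
    calc _ ≤ 1 * (μ.restrict (T ⁻¹' {t})) s := by gcongr; exact key1 t
      _ = _ := one_mul _
  have h2 : Q1.map Prod.snd ≤ ν := by
    refine Measure.le_iff.2 fun s hs => ?_
    rw [Measure.map_apply measurable_snd hs, hQ1, Measure.finsetSum_apply, ← decomp ν s hs]
    refine Finset.sum_le_sum fun t _ => ?_
    rw [← Measure.map_apply measurable_snd hs, hR]
    simp only [Measure.map_smul, Measure.map_snd_prod, Measure.smul_apply, smul_eq_mul,
      Measure.restrict_apply_univ]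
    rw [← mul_assoc]
    calc _ ≤ 1 * (ν.restrict (T ⁻¹' {t})) s := by gcongr; exact key2 t
      _ = _ := one_mul _
  obtain ⟨Q, hQ, hq1, hq2, hq3⟩ := complete_coupling μ ν Q1 h1 h2
  refine ⟨Q, hQ, hq1, hq2, ?_⟩
  have hz : Q1 {p | T p.1 ≠ T p.2} = 0 := by
    rw [hQ1, Measure.finsetSum_apply]
    refine Finset.sum_eq_zero fun t _ => ?_
    rw [hR]
    simp only [Measure.smul_apply, smul_eq_mul, Measure.prod_restrict]
    rw [Measure.restrict_apply' ((T.measurableSet_fiber t).prod (T.measurableSet_fiber t))]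
    have : {p : X × X | T p.1 ≠ T p.2} ∩ (T ⁻¹' {t}) ×ˢ (T ⁻¹' {t}) = ∅ := by
      ext p
      simp only [Set.mem_inter_iff, Set.mem_ofPred_eq, Set.mem_prod, Set.mem_preimage,
        Set.mem_singleton_iff, Set.mem_empty_iff_false, iff_false]
      rintro ⟨h, h', h''⟩
      exact h (h'.trans h''.symm)
    rw [this]; simp
  have hu : Q1 Set.univ = ∑ t ∈ T.range, m t := by
    rw [hQ1, Measure.finsetSum_apply]
    refine Finset.sum_congr rfl fun t _ => ?_
    rw [hR]
    simp only [Measure.smul_apply, smul_eq_mul]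
    rw [← Set.univ_prod_univ, Measure.prod_prod, Measure.restrict_apply_univ,
      Measure.restrict_apply_univ]
    change m t * (a t)⁻¹ * (b t)⁻¹ * (a t * b t) = m t
    by_cases h : a t = 0
    · simp [hm, h]
    by_cases h' : b t = 0
    · simp [hm, h']
    calc _ = m t * ((a t)⁻¹ * a t) * ((b t)⁻¹ * b t) := by ring
      _ = m t := by rw [ENNReal.inv_mul_cancel h (hat t), ENNReal.inv_mul_cancel h' (hbt t)]; simp
  have hA : ∑ t ∈ T.range, a t = 1 := by
    have := SimpleFunc.sum_range_measure_preimage_singleton T μ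
    rwa [measure_univ] at this
  have hm1 : ∀ t ∈ T.range, m t ≠ ⊤ := fun t _ => ((min_le_left _ _).trans_lt (hat t).lt_top).ne
  have hle : ∑ t ∈ T.range, m t ≤ 1 := by
    rw [← hA]; exact Finset.sum_le_sum fun t _ => min_le_left _ _
  have h3 := hq3 {p | T p.1 ≠ T p.2}
  rw [hz, zero_add, hu] at h3
  have h4 := ENNReal.toReal_mono (by simp) h3
  rw [ENNReal.toReal_sub_of_le hle (by simp), ENNReal.toReal_sum hm1] at h4
  have hA' : ∑ t ∈ T.range, (a t).toReal = 1 := by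
    rw [← ENNReal.toReal_sum fun t _ => hat t, hA]; simp
  change (Q _).toReal ≤ _
  refine h4.trans ?_
  rw [ENNReal.toReal_one, ← hA', ← Finset.sum_sub_distrib]
  refine Finset.sum_le_sum fun t _ => ?_
  rw [hm, ENNReal.toReal_min (hat t) (hbt t)]
  change (a t).toReal - _ ≤ |(a t).toReal - (b t).toReal|
  rcases min_cases (a t).toReal (b t).toReal with h | h
  · rw [h.1]; simp
  · rw [h.1]; exact le_abs_self _

lemma integral_add_three {α : Type*} [MeasurableSpace α] {μ : Measure α} {f g h : α → ℝ}
    (hf : Integrable f μ) (hg : Integrable g μ) (hh : Integrable h μ) :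
    ∫ x, (f x + g x + h x) ∂μ = ∫ x, f x ∂μ + ∫ x, g x ∂μ + ∫ x, h x ∂μ := by
  rw [← integral_add hf hg]
  exact integral_add (hf.add hg) hh

lemma wasserstein_sq_le {k : ℕ} (μ ν : Measure (EuclideanSpace ℝ (Fin k)))
    [IsProbabilityMeasure μ] [IsProbabilityMeasure ν]
    (T : SimpleFunc (EuclideanSpace ℝ (Fin k)) (EuclideanSpace ℝ (Fin k)))
    (C : ℝ) (hC : ∀ x y, ‖T x - T y‖ ^ 2 ≤ C)
    (hμ : Integrable (fun x => ‖x - T x‖ ^ 2) μ) (hν : Integrable (fun x => ‖x - T x‖ ^ 2) ν) :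
    (wassersteinDist μ ν) ^ 2 ≤ 3 * ∫ x, ‖x - T x‖ ^ 2 ∂μ + 3 * ∫ x, ‖x - T x‖ ^ 2 ∂ν
      + 3 * C * ∑ t ∈ T.range, |μ.real (T ⁻¹' {t}) - ν.real (T ⁻¹' {t})| := by
  have hC0 : 0 ≤ C := (sq_nonneg _).trans (hC 0 0)
  obtain ⟨Q, hQ, h1, h2, h3⟩ := exists_coupling μ ν T
  have hTm : Measurable T := T.measurable
  have hD : MeasurableSet {p : EuclideanSpace ℝ (Fin k) × EuclideanSpace ℝ (Fin k) |
      T p.1 ≠ T p.2} :=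
    (measurableSet_eq_fun (hTm.comp measurable_fst) (hTm.comp measurable_snd)).compl
  set D := {p : EuclideanSpace ℝ (Fin k) × EuclideanSpace ℝ (Fin k) | T p.1 ≠ T p.2} with hDdef
  have i1 : Integrable (fun p : EuclideanSpace ℝ (Fin k) × EuclideanSpace ℝ (Fin k) =>
      ‖p.1 - T p.1‖ ^ 2) Q := by
    rw [← h1] at hμ
    exact hμ.comp_measurable measurable_fst
  have i2 : Integrable (fun p : EuclideanSpace ℝ (Fin k) × EuclideanSpace ℝ (Fin k) =>
      ‖p.2 - T p.2‖ ^ 2) Q := by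
    rw [← h2] at hν
    exact hν.comp_measurable measurable_snd
  have i3 : Integrable (D.indicator (fun _ => (1 : ℝ))) Q := (integrable_const 1).indicator hD
  have e1 : ∫ p, ‖p.1 - T p.1‖ ^ 2 ∂Q = ∫ x, ‖x - T x‖ ^ 2 ∂μ := by
    rw [← h1] at hμ
    conv_rhs => rw [← h1]
    rw [integral_map measurable_fst.aemeasurable hμ.aestronglyMeasurable]
  have e2 : ∫ p, ‖p.2 - T p.2‖ ^ 2 ∂Q = ∫ x, ‖x - T x‖ ^ 2 ∂ν := by
    rw [← h2] at hν
    conv_rhs => rw [← h2]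
    rw [integral_map measurable_snd.aemeasurable hν.aestronglyMeasurable]
  have e3 : ∫ p, D.indicator (fun _ => (1 : ℝ)) p ∂Q = Q.real D := integral_indicator_one hD
  have bd : ∀ p : EuclideanSpace ℝ (Fin k) × EuclideanSpace ℝ (Fin k), ‖p.1 - p.2‖ ^ 2 ≤
      3 * ‖p.1 - T p.1‖ ^ 2 + 3 * ‖p.2 - T p.2‖ ^ 2 + 3 * C * D.indicator (fun _ => (1 : ℝ)) p := by
    intro p
    have hT : ‖T p.1 - T p.2‖ ^ 2 ≤ C * D.indicator (fun _ => (1 : ℝ)) p := by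
      by_cases h : T p.1 = T p.2
      · have : p ∉ D := fun h' => h' h
        simp [this, h]
      · have : p ∈ D := h
        simpa [this] using hC p.1 p.2
    have tri : ‖p.1 - p.2‖ ≤ ‖p.1 - T p.1‖ + ‖T p.1 - T p.2‖ + ‖p.2 - T p.2‖ := by
      have : p.1 - p.2 = (p.1 - T p.1) + (T p.1 - T p.2) - (p.2 - T p.2) := by abel
      rw [this]
      exact (norm_sub_le _ _).trans (by gcongr; exact norm_add_le _ _)
    have := pow_le_pow_left₀ (norm_nonneg _) tri 2
    nlinarith [sq_nonneg (‖p.1 - T p.1‖ - ‖T p.1 - T p.2‖),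
      sq_nonneg (‖p.1 - T p.1‖ - ‖p.2 - T p.2‖), sq_nonneg (‖T p.1 - T p.2‖ - ‖p.2 - T p.2‖)]
  have i4 := ((i1.const_mul 3).add (i2.const_mul 3)).add (i3.const_mul (3 * C))
  have i5 : Integrable (fun p : EuclideanSpace ℝ (Fin k) × EuclideanSpace ℝ (Fin k) =>
      ‖p.1 - p.2‖ ^ 2) Q := by
    refine i4.mono' (by fun_prop) (.of_forall fun p => ?_)
    rw [Real.norm_of_nonneg (by positivity)]
    exact bd p
  have hint : ∫ p, ‖p.1 - p.2‖ ^ 2 ∂Q ≤ 3 * ∫ x, ‖x - T x‖ ^ 2 ∂μ + 3 * ∫ x, ‖x - T x‖ ^ 2 ∂ν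
      + 3 * C * Q.real D := by
    refine (integral_mono i5 i4 bd).trans_eq ?_
    simp only [Pi.add_apply]
    rw [integral_add_three (i1.const_mul 3) (i2.const_mul 3) (i3.const_mul (3 * C)),
      integral_const_mul, integral_const_mul, integral_const_mul, e1, e2, e3]
  have hW0 : 0 ≤ wassersteinDist μ ν := by
    refine Real.sInf_nonneg ?_
    rintro r ⟨_, _, _, _, _, rfl⟩
    exact Real.sqrt_nonneg _
  have hW : wassersteinDist μ ν ≤ Real.sqrt (∫ p, ‖p.1 - p.2‖ ^ 2 ∂Q) := by
    refine csInf_le ⟨0, ?_⟩ ⟨Q, hQ, h1, h2, i5, rfl⟩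
    rintro r ⟨_, _, _, _, _, rfl⟩
    exact Real.sqrt_nonneg _
  have hW2 := pow_le_pow_left₀ hW0 hW 2
  rw [Real.sq_sqrt (integral_nonneg fun p => by positivity)] at hW2
  refine hW2.trans (hint.trans ?_)
  gcongr

lemma isProb_empirical {k : ℕ} {Ω : Type*} (ξ : ℕ → Ω → EuclideanSpace ℝ (Fin k)) (n : ℕ)
    (hn : n ≠ 0) (ω : Ω) : IsProbabilityMeasure (empiricalMeasure ξ n ω) := by
  constructor
  simp only [empiricalMeasure, Measure.smul_apply, Measure.finsetSum_apply, measure_univ,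
    Finset.sum_const, Finset.card_range, nsmul_eq_mul, mul_one, smul_eq_mul]
  exact ENNReal.inv_mul_cancel (by simpa using hn) (by simp)

lemma integral_empirical {k : ℕ} {Ω : Type*} (ξ : ℕ → Ω → EuclideanSpace ℝ (Fin k)) (n : ℕ)
    (hn : n ≠ 0) (ω : Ω) (f : EuclideanSpace ℝ (Fin k) → ℝ) :
    Integrable f (empiricalMeasure ξ n ω) ∧
    ∫ x, f x ∂(empiricalMeasure ξ n ω) = (n : ℝ)⁻¹ * ∑ j ∈ Finset.range n, f (ξ j ω) := by
  have h : ∀ j ∈ Finset.range n, Integrable f (Measure.dirac (ξ j ω)) := fun j _ =>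
    integrable_dirac (by simp)
  constructor
  · exact (integrable_finsetSum_measure.2 h).smul_measure (by simpa using hn)
  · rw [empiricalMeasure, integral_smul_measure, integral_finsetSum_measure h]
    simp

lemma main_aux {k : ℕ} {Ω : Type*} [MeasurableSpace Ω]
    (P : Measure Ω) [IsProbabilityMeasure P]
    (ν : Measure (EuclideanSpace ℝ (Fin k))) [IsProbabilityMeasure ν]
    (ξ : ℕ → Ω → EuclideanSpace ℝ (Fin k))
    (hmeas : ∀ i, Measurable (ξ i))
    (hindep : iIndepFun ξ P)
    (hlaw : ∀ i, P.map (ξ i) = ν) (A : Set (EuclideanSpace ℝ (Fin k))) (hA : MeasurableSet A) :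
    Filter.Tendsto (fun n => ∫ ω, |(empiricalMeasure ξ n ω).real A - ν.real A| ∂P)
      Filter.atTop (nhds 0) ∧
    ∀ n ≠ 0, Integrable (fun ω => |(empiricalMeasure ξ n ω).real A - ν.real A|) P := by
  set g : EuclideanSpace ℝ (Fin k) → ℝ := A.indicator 1 with hg
  have hgm : Measurable g := measurable_one.indicator hA
  have hgi : Integrable g ν := (integrable_const (1:ℝ)).indicator hA
  have hXi : ∀ i, Integrable (fun ω => g (ξ i ω)) P := fun i => by
    have : Integrable g (P.map (ξ i)) := by rwa [hlaw i]
    exact this.comp_measurable (hmeas i)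
  have hE : ∫ ω, g (ξ 0 ω) ∂P = ν.real A := by
    rw [← integral_map (hmeas 0).aemeasurable hgm.aestronglyMeasurable, hlaw 0, hg,
      integral_indicator_one hA]
  have hemp : ∀ n ≠ 0, ∀ ω, (empiricalMeasure ξ n ω).real A
      = (n : ℝ)⁻¹ • ∑ j ∈ Finset.range n, g (ξ j ω) := by
    intro n hn ω
    rw [smul_eq_mul, ← (integral_empirical ξ n hn ω g).2, hg, integral_indicator_one hA]
  have hint : ∀ n : ℕ, Integrable (fun ω => (n : ℝ)⁻¹ • ∑ j ∈ Finset.range n, g (ξ j ω)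
      - ∫ ω, g (ξ 0 ω) ∂P) P := fun n =>
    ((integrable_finsetSum _ fun j _ => hXi j).smul (n:ℝ)⁻¹).sub (integrable_const _)
  constructor
  · have := strong_law_Lp (μ := P) (p := 1) le_rfl (by simp) (fun i ω => g (ξ i ω))
      (memLp_one_iff_integrable.2 (hXi 0))
      (fun i j hij => (hindep.indepFun hij).comp hgm hgm)
      (fun i => (IdentDistrib.mk (hmeas i).aemeasurable (hmeas 0).aemeasurable
        (by rw [hlaw, hlaw])).comp hgm)
    have := (ENNReal.tendsto_toReal (by simp)).comp this
    rw [ENNReal.toReal_zero] at this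
    refine this.congr' ?_
    filter_upwards [Filter.eventually_ne_atTop 0] with n hn
    simp only [Function.comp]
    rw [eLpNorm_one_eq_lintegral_enorm, ← integral_norm_eq_lintegral_enorm (hint n).1]
    refine integral_congr_ae (.of_forall fun ω => ?_)
    simp only [hemp n hn ω, Real.norm_eq_abs, hE]
  · intro n hn
    have := (hint n).norm
    refine this.congr (.of_forall fun ω => ?_)
    simp only [hemp n hn ω, Real.norm_eq_abs, hE]

/-- If `ν` is a probability measure on `ℝ^k` with finite second moment and `ν^n` is the
empirical measure of an i.i.d. sample from `ν`, then `E[d²(ν^n, ν)] → 0` as `n → ∞`. -/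
theorem expectation_sq_wasserstein_empirical_tendsto {k : ℕ} {Ω : Type*} [MeasurableSpace Ω]
    (P : Measure Ω) [IsProbabilityMeasure P]
    (ν : Measure (EuclideanSpace ℝ (Fin k))) [IsProbabilityMeasure ν]
    (hν2 : Integrable (fun x => ‖x‖ ^ 2) ν)
    (ξ : ℕ → Ω → EuclideanSpace ℝ (Fin k))
    (hmeas : ∀ i, Measurable (ξ i))
    (hindep : iIndepFun ξ P)
    (hlaw : ∀ i, P.map (ξ i) = ν) :
    Filter.Tendsto
      (fun n => ∫ ω, (wassersteinDist (empiricalMeasure ξ n ω) ν) ^ 2 ∂P)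
      Filter.atTop (nhds 0) := by
  have hid : MemLp (id : EuclideanSpace ℝ (Fin k) → EuclideanSpace ℝ (Fin k)) 2 ν :=
    (memLp_two_iff_integrable_sq_norm aestronglyMeasurable_id).2 hν2
  rw [Metric.tendsto_atTop']
  intro ε hε
  obtain ⟨T, hT, hT2⟩ := hid.exists_simpleFunc_eLpNorm_sub_lt (by simp)
    (ε := ENNReal.ofReal (Real.sqrt (ε / 12))) (by simpa using by positivity)
  have hfL : MemLp (fun x => x - T x) 2 ν := hid.sub hT2
  have hf : Integrable (fun x => ‖x - T x‖ ^ 2) ν :=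
    (memLp_two_iff_integrable_sq_norm hfL.1).1 hfL
  have hfe : ∫ x, ‖x - T x‖ ^ 2 ∂ν < ε / 12 := by
    have h1 := hfL.eLpNorm_eq_integral_rpow_norm (by simp) (by simp)
    have h2 : eLpNorm (fun x => x - T x) 2 ν < ENNReal.ofReal (Real.sqrt (ε / 12)) := hT
    rw [h1, ENNReal.ofReal_lt_ofReal_iff (by positivity)] at h2
    simp only [ENNReal.toReal_ofNat, Real.rpow_ofNat] at h2
    rw [show (2:ℝ)⁻¹ = 1 / 2 by norm_num, ← Real.sqrt_eq_rpow] at h2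
    exact (Real.sqrt_lt_sqrt_iff (integral_nonneg fun x => by positivity)).1 h2
  set f : EuclideanSpace ℝ (Fin k) → ℝ := fun x => ‖x - T x‖ ^ 2 with hfdef
  obtain ⟨B, hB⟩ : ∃ B, ∀ x, ‖T x‖ ≤ B := by
    obtain ⟨B, hB⟩ := T.exists_forall_norm_le
    exact ⟨B, hB⟩
  set C : ℝ := (B + B) ^ 2 with hCdef
  have hC : ∀ x y, ‖T x - T y‖ ^ 2 ≤ C := fun x y =>
    pow_le_pow_left₀ (norm_nonneg _) ((norm_sub_le _ _).trans (add_le_add (hB x) (hB y))) 2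
  have hfi : ∀ i, Integrable (fun ω => f (ξ i ω)) P := fun i => by
    have : Integrable f (P.map (ξ i)) := by rwa [hlaw i]
    exact this.comp_measurable (hmeas i)
  have hfE : ∀ i, ∫ ω, f (ξ i ω) ∂P = ∫ x, f x ∂ν := fun i => by
    rw [← integral_map (hmeas i).aemeasurable (by rw [hlaw i]; exact hf.1), hlaw i]
  have aux := fun t => main_aux P ν ξ hmeas hindep hlaw (T ⁻¹' {t}) (T.measurableSet_fiber t)
  have lim : Filter.Tendsto (fun n => 3 * C * ∑ t ∈ T.range,
      ∫ ω, |(empiricalMeasure ξ n ω).real (T ⁻¹' {t}) - ν.real (T ⁻¹' {t})| ∂P)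
      Filter.atTop (nhds 0) := by
    have := (tendsto_finsetSum T.range fun t _ => (aux t).1).const_mul (3 * C)
    simpa using this
  have hev := lim.eventually_lt_const (show (0:ℝ) < ε / 2 by positivity)
  have hev' := hev.and (Filter.eventually_ne_atTop 0)
  obtain ⟨N, hN⟩ := Filter.eventually_atTop.1 hev'
  refine ⟨N, fun n hn => ?_⟩
  obtain ⟨hlt, hn0⟩ := hN n hn.le
  have hnonneg : 0 ≤ ∫ ω, (wassersteinDist (empiricalMeasure ξ n ω) ν) ^ 2 ∂P :=
    integral_nonneg fun ω => sq_nonneg _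
  rw [Real.dist_eq, sub_zero, abs_of_nonneg hnonneg]
  have j1 : Integrable (fun ω => 3 * ((n : ℝ)⁻¹ * ∑ j ∈ Finset.range n, f (ξ j ω))) P :=
    ((integrable_finsetSum _ fun j _ => hfi j).const_mul _).const_mul _
  have j2 : Integrable (fun _ : Ω => 3 * ∫ x, f x ∂ν) P := integrable_const _
  have j3' : Integrable (fun ω => ∑ t ∈ T.range,
      |(empiricalMeasure ξ n ω).real (T ⁻¹' {t}) - ν.real (T ⁻¹' {t})|) P :=
    integrable_finsetSum _ fun t _ => (aux t).2 n hn0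
  have j3 := j3'.const_mul (3 * C)
  have hle : ∫ ω, (wassersteinDist (empiricalMeasure ξ n ω) ν) ^ 2 ∂P ≤
      ∫ ω, (3 * ((n : ℝ)⁻¹ * ∑ j ∈ Finset.range n, f (ξ j ω)) + 3 * ∫ x, f x ∂ν +
        3 * C * ∑ t ∈ T.range,
          |(empiricalMeasure ξ n ω).real (T ⁻¹' {t}) - ν.real (T ⁻¹' {t})|) ∂P := by
    refine integral_mono_of_nonneg (.of_forall fun ω => sq_nonneg _) ((j1.add j2).add j3)
      (.of_forall fun ω => ?_)
    have := isProb_empirical ξ n hn0 ω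
    have := wasserstein_sq_le (empiricalMeasure ξ n ω) ν T C hC
      (integral_empirical ξ n hn0 ω f).1 hf
    rw [(integral_empirical ξ n hn0 ω f).2] at this
    exact this
  rw [integral_add_three j1 j2 j3, integral_const_mul, integral_const_mul,
    integral_finsetSum _ (fun j _ => hfi j), integral_const_mul, integral_const_mul,
    integral_finsetSum _ (fun t _ => (aux t).2 n hn0)] at hle
  have hn' : (n : ℝ) ≠ 0 := by exact_mod_cast hn0
  simp only [hfE, Finset.sum_const, Finset.card_range, nsmul_eq_mul, integral_const,
    probReal_univ, one_smul, inv_mul_cancel_left₀ hn'] at hle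
  linarith
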